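/- arXiv:2002.06482 — 2 statements merged into one kernel-verified Lean document; each statement's English description precedes it below -/
import Mathlib

section
/- Let c ≥ 2 be an integer, let 0 ≤ t1 < 1, and let L be the Bi-Tempered classification loss L_Bi with parameter t1. Let 0 ≤ η < 1 − 1/c. Suppose f* is a global minimizer of the clean risk R_L over all measurable classifiers and f̂ is a global minimizer of the symmetric-noise risk R_L^η over all measurable classifiers. Then A' ≤ R_L(f*) − R_L(f̂) ≤ 0, where A' = η(c − c^{t1}) / ((c−1−ηc)(1−t1)(2−t1)) − η(c−1) / ((1−t1)(c−1−ηc)) ≤ 0. -/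
open MeasureTheory

/-- A prediction: a probability vector over `c` classes. -/
def IsPred (c : ℕ) (p : Fin c → ℝ) : Prop :=
  (∀ j, 0 ≤ p j) ∧ ∑ j, p j = 1

/-- A classifier: a measurable map into the set of predictions. -/
def IsClassifier {X : Type*} [MeasurableSpace X] (c : ℕ) (f : X → Fin c → ℝ) : Prop :=
  Measurable f ∧ ∀ x, IsPred c (f x)

/-- Clean risk `R_L(f) = E_{(x,y)∼μ}[L(f(x), y)]`. -/
noncomputable def cleanRisk {X : Type*} [MeasurableSpace X] {c : ℕ}
    (μ : Measure (X × Fin c)) (L : (Fin c → ℝ) → Fin c → ℝ) (f : X → Fin c → ℝ) : ℝ :=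
  ∫ z, L (f z.1) z.2 ∂μ

/-- Risk under symmetric label noise of rate `η`:
`R_L^η(f) = E[(1−η)·L(f(x), y) + (η/(c−1))·Σ_{j≠y} L(f(x), j)]`. -/
noncomputable def noisyRisk {X : Type*} [MeasurableSpace X] {c : ℕ}
    (μ : Measure (X × Fin c)) (L : (Fin c → ℝ) → Fin c → ℝ) (η : ℝ)
    (f : X → Fin c → ℝ) : ℝ :=
  ∫ z, ((1 - η) * L (f z.1) z.2
    + (η / ((c : ℝ) - 1)) * ∑ j ∈ Finset.univ.erase z.2, L (f z.1) j) ∂μ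

/-- Tempered logarithm `log_t(x) = (x^{1−t} − 1)/(1−t)` (real rpow gives `0^{1−t} = 0` for `t < 1`). -/
noncomputable def tLog (t x : ℝ) : ℝ := (x ^ (1 - t) - 1) / (1 - t)

/-- The Bi-Tempered loss `L_Bi(p, j) = −log_{t1}(p_j) + (1/(2−t1))·(1 − Σ_k p_k^{2−t1})`. -/
noncomputable def biLoss {c : ℕ} (t1 : ℝ) (p : Fin c → ℝ) (j : Fin c) : ℝ :=
  -tLog t1 (p j) + (1 / (2 - t1)) * (1 - ∑ k, (p k) ^ (2 - t1))

open Finset in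
/-- Hölder's upper bound for the power sum of a prediction, with exponent at most one. -/
lemma IsPred.sum_rpow_le {c : ℕ} {p : Fin c → ℝ} (hp : IsPred c p) {a : ℝ} (ha : 0 < a)
    (ha1 : a ≤ 1) : ∑ j, p j ^ a ≤ (c : ℝ) ^ (1 - a) := by
  have h := Real.rpow_sum_le_const_mul_sum_rpow_of_nonneg (s := univ) (f := fun j => p j ^ a)
    (p := 1 / a) ((one_le_div ha).2 ha1) (fun j _ => Real.rpow_nonneg (hp.1 j) a)
  have hpow (j : Fin c) : (p j ^ a) ^ (1 / a) = p j := by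
    rw [← Real.rpow_mul (hp.1 j), mul_one_div_cancel ha.ne', Real.rpow_one]
  simp only [hpow, hp.2, mul_one, card_univ, Fintype.card_fin] at h
  have hs : 0 ≤ ∑ j, p j ^ a := sum_nonneg fun j _ => Real.rpow_nonneg (hp.1 j) a
  have h' := Real.rpow_le_rpow (Real.rpow_nonneg hs _) h ha.le
  rwa [← Real.rpow_mul hs, ← Real.rpow_mul (Nat.cast_nonneg c), one_div_mul_cancel ha.ne',
    Real.rpow_one, sub_mul, one_div_mul_cancel ha.ne', one_mul] at h'

lemma IsPred.le_one {c : ℕ} {p : Fin c → ℝ} (hp : IsPred c p) (j : Fin c) : p j ≤ 1 :=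
  hp.2 ▸ Finset.single_le_sum (fun k _ => hp.1 k) (Finset.mem_univ j)

lemma IsPred.one_le_sum_rpow {c : ℕ} {p : Fin c → ℝ} (hp : IsPred c p) {a : ℝ}
    (ha1 : a ≤ 1) : 1 ≤ ∑ j, p j ^ a :=
  hp.2 ▸ Finset.sum_le_sum fun j _ =>
    Real.self_le_rpow_of_le_one (hp.1 j) (hp.le_one j) ha1

lemma IsPred.sum_rpow_le_one {c : ℕ} {p : Fin c → ℝ} (hp : IsPred c p) {b : ℝ} (hb : 1 ≤ b) :
    ∑ j, p j ^ b ≤ 1 :=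
  hp.2 ▸ Finset.sum_le_sum fun j _ =>
    Real.rpow_le_self_of_le_one (hp.1 j) (hp.le_one j) hb

/-- Hölder's lower bound for the power sum of a prediction, with exponent at least one. -/
lemma IsPred.le_mul_sum_rpow {c : ℕ} {p : Fin c → ℝ} (hp : IsPred c p) (hc : 0 < c) {b : ℝ}
    (hb : 1 ≤ b) : (c : ℝ) ^ (2 - b) ≤ c * ∑ j, p j ^ b := by
  have h := Real.rpow_sum_le_const_mul_sum_rpow_of_nonneg (s := Finset.univ) (f := p)
    hb (fun j _ => hp.1 j)
  simp only [hp.2, Real.one_rpow, Finset.card_univ, Fintype.card_fin] at h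
  have hc' : (0 : ℝ) < c := Nat.cast_pos.2 hc
  calc (c : ℝ) ^ (2 - b) = (c : ℝ) ^ (2 - b) * 1 := (mul_one _).symm
    _ ≤ (c : ℝ) ^ (2 - b) * ((c : ℝ) ^ (b - 1) * ∑ j, p j ^ b) := by gcongr
    _ = c * ∑ j, p j ^ b := by
      rw [← mul_assoc, ← Real.rpow_add hc', show 2 - b + (b - 1) = (1 : ℝ) by ring,
        Real.rpow_one]

lemma sum_biLoss {c : ℕ} (t1 : ℝ) (p : Fin c → ℝ) :
    ∑ j, biLoss t1 p j = ((c : ℝ) - ∑ j, p j ^ (1 - t1)) / (1 - t1)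
      + ((c : ℝ) - c * ∑ j, p j ^ (2 - t1)) / (2 - t1) := by
  simp only [biLoss, tLog, Finset.sum_add_distrib, Finset.sum_neg_distrib, ← Finset.sum_div,
    Finset.sum_sub_distrib, Finset.sum_const, Finset.card_univ, Fintype.card_fin, nsmul_eq_mul,
    mul_one]
  ring

lemma IsPred.le_sum_biLoss {c : ℕ} {p : Fin c → ℝ} (hp : IsPred c p) {t1 : ℝ} (ht0 : 0 ≤ t1)
    (ht1 : t1 < 1) : ((c : ℝ) - (c : ℝ) ^ t1) / (1 - t1) ≤ ∑ j, biLoss t1 p j := by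
  have h1 := hp.sum_rpow_le (a := 1 - t1) (by linarith) (by linarith)
  rw [sub_sub_cancel] at h1
  have h2 := hp.sum_rpow_le_one (b := 2 - t1) (by linarith)
  have h3 : (c : ℝ) * ∑ j, p j ^ (2 - t1) ≤ c := mul_le_of_le_one_right (Nat.cast_nonneg c) h2
  rw [sum_biLoss]
  have ha : 0 < 1 - t1 := by linarith
  have h4 : 0 ≤ ((c : ℝ) - c * ∑ j, p j ^ (2 - t1)) / (2 - t1) :=
    div_nonneg (by linarith) (by linarith)
  have h5 : ((c : ℝ) - (c : ℝ) ^ t1) / (1 - t1) ≤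
      ((c : ℝ) - ∑ j, p j ^ (1 - t1)) / (1 - t1) := by gcongr
  linarith

lemma IsPred.sum_biLoss_le {c : ℕ} {p : Fin c → ℝ} (hp : IsPred c p) (hc : 0 < c) {t1 : ℝ}
    (ht0 : 0 ≤ t1) (ht1 : t1 < 1) :
    ∑ j, biLoss t1 p j ≤ ((c : ℝ) - 1) / (1 - t1) + ((c : ℝ) - (c : ℝ) ^ t1) / (2 - t1) := by
  have h1 := hp.one_le_sum_rpow (a := 1 - t1) (by linarith)
  have h2 := hp.le_mul_sum_rpow hc (b := 2 - t1) (by linarith)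
  rw [sub_sub_cancel] at h2
  rw [sum_biLoss]
  have ha : 0 < 1 - t1 := by linarith
  have hb : 0 < 2 - t1 := by linarith
  gcongr

lemma IsPred.biLoss_nonneg {c : ℕ} {p : Fin c → ℝ} (hp : IsPred c p) {t1 : ℝ} (ht1 : t1 < 1)
    (j : Fin c) : 0 ≤ biLoss t1 p j := by
  have h1 : p j ^ (1 - t1) ≤ 1 := Real.rpow_le_one (hp.1 j) (hp.le_one j) (by linarith)
  have h2 := hp.sum_rpow_le_one (b := 2 - t1) (by linarith)
  have h3 : tLog t1 (p j) ≤ 0 := div_nonpos_of_nonpos_of_nonneg (by linarith) (by linarith)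
  have h4 : 0 ≤ 1 / (2 - t1) * (1 - ∑ k, p k ^ (2 - t1)) :=
    mul_nonneg (one_div_nonneg.2 (by linarith)) (by linarith)
  unfold biLoss
  linarith

section Risk

variable {X : Type*} [MeasurableSpace X] {c : ℕ} {f : X → Fin c → ℝ}

lemma IsClassifier.measurable_biLoss (hf : IsClassifier c f) (t1 : ℝ) (j : Fin c) :
    Measurable fun x => biLoss t1 (f x) j := by
  have hm (k : Fin c) : Measurable fun x => f x k := (measurable_pi_apply k).comp hf.1
  unfold biLoss tLog
  fun_prop

lemma IsClassifier.integrable_sum_biLoss (hf : IsClassifier c f) (hc : 0 < c)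
    (μ : Measure (X × Fin c)) [IsFiniteMeasure μ] {t1 : ℝ} (ht0 : 0 ≤ t1) (ht1 : t1 < 1) :
    Integrable (fun z : X × Fin c => ∑ j, biLoss t1 (f z.1) j) μ := by
  refine Integrable.of_bound (Measurable.aestronglyMeasurable ?_)
    (((c : ℝ) - 1) / (1 - t1) + ((c : ℝ) - (c : ℝ) ^ t1) / (2 - t1)) (.of_forall fun z => ?_)
  · exact Finset.measurable_sum _ fun j _ => (hf.measurable_biLoss t1 j).comp measurable_fst
  · rw [Real.norm_of_nonneg (Finset.sum_nonneg fun j _ => (hf.2 z.1).biLoss_nonneg ht1 j)]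
    exact (hf.2 z.1).sum_biLoss_le hc ht0 ht1

lemma IsClassifier.integrable_biLoss (hf : IsClassifier c f) (hc : 0 < c)
    (μ : Measure (X × Fin c)) [IsFiniteMeasure μ] {t1 : ℝ} (ht0 : 0 ≤ t1) (ht1 : t1 < 1) :
    Integrable (fun z : X × Fin c => biLoss t1 (f z.1) z.2) μ := by
  refine (hf.integrable_sum_biLoss hc μ ht0 ht1).mono' (Measurable.aestronglyMeasurable ?_)
    (.of_forall fun z => ?_)
  · exact measurable_from_prod_countable_left fun j => hf.measurable_biLoss t1 j
  · rw [Real.norm_of_nonneg ((hf.2 z.1).biLoss_nonneg ht1 z.2)]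
    exact Finset.single_le_sum (fun j _ => (hf.2 z.1).biLoss_nonneg ht1 j) (Finset.mem_univ z.2)

/-- The noisy risk is an affine combination of the clean risk and the expected total loss. -/
lemma IsClassifier.noisyRisk_eq (hf : IsClassifier c f) (hc : 0 < c)
    (μ : Measure (X × Fin c)) [IsFiniteMeasure μ] {t1 : ℝ} (ht0 : 0 ≤ t1) (ht1 : t1 < 1)
    (η : ℝ) :
    noisyRisk μ (biLoss t1) η f = (1 - η - η / ((c : ℝ) - 1)) * cleanRisk μ (biLoss t1) f
      + η / ((c : ℝ) - 1) * ∫ z, ∑ j, biLoss t1 (f z.1) j ∂μ := by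
  rw [noisyRisk, cleanRisk, ← integral_const_mul, ← integral_const_mul,
    ← integral_add ((hf.integrable_biLoss hc μ ht0 ht1).const_mul _)
      ((hf.integrable_sum_biLoss hc μ ht0 ht1).const_mul _)]
  congr 1 with z
  rw [← Finset.add_sum_erase _ _ (Finset.mem_univ z.2)]
  ring

end Risk

/-- Theorem 2 (second part): clean-risk bound for the Bi-Tempered loss under symmetric noise. -/
theorem biTempered_cleanRisk_bound {X : Type*} [MeasurableSpace X] {c : ℕ} (hc : 2 ≤ c)
    (μ : Measure (X × Fin c)) [IsProbabilityMeasure μ]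
    (t1 η : ℝ) (ht0 : 0 ≤ t1) (ht1 : t1 < 1)
    (hη0 : 0 ≤ η) (hη1 : η < 1 - 1 / (c : ℝ))
    (fstar fhat : X → Fin c → ℝ)
    (hfstar : IsClassifier c fstar) (hfhat : IsClassifier c fhat)
    (hmin_clean : ∀ g, IsClassifier c g →
      cleanRisk μ (biLoss t1) fstar ≤ cleanRisk μ (biLoss t1) g)
    (hmin_noisy : ∀ g, IsClassifier c g →
      noisyRisk μ (biLoss t1) η fhat ≤ noisyRisk μ (biLoss t1) η g) :
    η * ((c : ℝ) - (c : ℝ) ^ t1) / (((c : ℝ) - 1 - η * c) * (1 - t1) * (2 - t1))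
      - η * ((c : ℝ) - 1) / ((1 - t1) * ((c : ℝ) - 1 - η * c)) ≤
      cleanRisk μ (biLoss t1) fstar - cleanRisk μ (biLoss t1) fhat ∧
    cleanRisk μ (biLoss t1) fstar - cleanRisk μ (biLoss t1) fhat ≤ 0 := by
  refine ⟨?_, sub_nonpos.2 (hmin_clean fhat hfhat)⟩
  have hc0 : 0 < c := by omega
  have hcR : (2 : ℝ) ≤ c := by exact_mod_cast hc
  have hc1 : (0 : ℝ) < c - 1 := by linarith
  have ha : 0 < 1 - t1 := by linarith
  have hb : 0 < 2 - t1 := by linarith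
  have hd : 0 < (c : ℝ) - 1 - η * c := by
    have h := mul_lt_mul_of_pos_right hη1 (show (0 : ℝ) < c by linarith)
    rw [sub_mul, one_div_mul_cancel (by linarith), one_mul] at h
    linarith
  have hnoisy := hmin_noisy fstar hfstar
  rw [hfstar.noisyRisk_eq hc0 μ ht0 ht1, hfhat.noisyRisk_eq hc0 μ ht0 ht1] at hnoisy
  have hlo : ((c : ℝ) - (c : ℝ) ^ t1) / (1 - t1) ≤ ∫ z, ∑ j, biLoss t1 (fhat z.1) j ∂μ := by
    simpa using integral_mono (integrable_const _) (hfhat.integrable_sum_biLoss hc0 μ ht0 ht1)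
      fun z => (hfhat.2 z.1).le_sum_biLoss ht0 ht1
  have hhi : ∫ z, ∑ j, biLoss t1 (fstar z.1) j ∂μ ≤
      ((c : ℝ) - 1) / (1 - t1) + ((c : ℝ) - (c : ℝ) ^ t1) / (2 - t1) := by
    simpa using integral_mono (hfstar.integrable_sum_biLoss hc0 μ ht0 ht1) (integrable_const _)
      fun z => (hfstar.2 z.1).sum_biLoss_le hc0 ht0 ht1
  generalize ∫ z, ∑ j, biLoss t1 (fhat z.1) j ∂μ = S at *
  generalize ∫ z, ∑ j, biLoss t1 (fstar z.1) j ∂μ = T at *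
  generalize cleanRisk μ (biLoss t1) fhat = R at *
  generalize cleanRisk μ (biLoss t1) fstar = Q at *
  have hscale : ((c : ℝ) - 1) * (1 - η - η / ((c : ℝ) - 1)) = (c : ℝ) - 1 - η * c := by
    field_simp
    ring
  have hscale' : ((c : ℝ) - 1) * (η / ((c : ℝ) - 1)) = η := mul_div_cancel₀ _ hc1.ne'
  have hkey : η * (S - T) ≤ ((c : ℝ) - 1 - η * c) * (Q - R) := by
    have h := mul_le_mul_of_nonneg_left hnoisy hc1.le
    simp only [mul_add, ← mul_assoc, hscale, hscale'] at h
    linarith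
  have hST := mul_le_mul_of_nonneg_left (sub_le_sub hlo hhi) hη0
  calc _ = η * (((c : ℝ) - (c : ℝ) ^ t1) / (1 - t1)
        - (((c : ℝ) - 1) / (1 - t1) + ((c : ℝ) - (c : ℝ) ^ t1) / (2 - t1)))
          / ((c : ℝ) - 1 - η * c) := by
        field_simp
        ring
    _ ≤ Q - R := by
        rw [div_le_iff₀' hd]
        exact hST.trans hkey
end

section
/- Let c ≥ 2 be an integer and L(p, j) a bounded measurable loss on predictions and labels satisfying the bounded-sum condition: there exist constants C_1 ≤ C_2 such that C_1 ≤ Σ_{j=1}^c L(p, j) ≤ C_2 for every prediction p. Let 0 ≤ η ≤ 1 − 1/c. If f* is a global minimizer of the clean risk R_L over all measurable classifiers and f̂ is a global minimizer of the symmetric-noise risk R_L^η over all measurable classifiers, then 0 ≤ R_L^η(f*) − R_L^η(f̂) ≤ (η/(c−1))·(C_2 − C_1). -/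
open MeasureTheory

section NoisyRisk

variable {X : Type*} [MeasurableSpace X] {c : ℕ} {μ : Measure (X × Fin c)}
  [IsProbabilityMeasure μ] {L : (Fin c → ℝ) → Fin c → ℝ} {f : X → Fin c → ℝ}

/-- The loss of a classifier against a measurably chosen label is integrable. -/
theorem IsClassifier.integrable_loss
    (hLmeas : Measurable fun pj : (Fin c → ℝ) × Fin c => L pj.1 pj.2)
    (hLbd : ∃ B : ℝ, ∀ p : Fin c → ℝ, IsPred c p → ∀ j, |L p j| ≤ B)
    (hf : IsClassifier c f) {y : X × Fin c → Fin c} (hy : Measurable y) :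
    Integrable (fun z => L (f z.1) (y z)) μ := by
  obtain ⟨B, hB⟩ := hLbd
  refine Integrable.of_bound
    (hLmeas.comp ((hf.1.comp measurable_fst).prodMk hy)).aestronglyMeasurable B ?_
  exact Filter.Eventually.of_forall fun z => hB _ (hf.2 z.1) _

/-- The noisy risk is a combination of the clean risk and the expected sum of the losses. -/
theorem IsClassifier.noisyRisk_eq_s6
    (hLmeas : Measurable fun pj : (Fin c → ℝ) × Fin c => L pj.1 pj.2)
    (hLbd : ∃ B : ℝ, ∀ p : Fin c → ℝ, IsPred c p → ∀ j, |L p j| ≤ B)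
    (hf : IsClassifier c f) (η : ℝ) :
    noisyRisk μ L η f = (1 - η - η / ((c : ℝ) - 1)) * cleanRisk μ L f
      + η / ((c : ℝ) - 1) * ∫ z, ∑ j, L (f z.1) j ∂μ := by
  have hclean := hf.integrable_loss (μ := μ) hLmeas hLbd measurable_snd
  have hsum : Integrable (fun z : X × Fin c => ∑ j, L (f z.1) j) μ :=
    integrable_finsetSum _ fun j _ =>
      hf.integrable_loss (y := fun _ => j) hLmeas hLbd measurable_const
  rw [noisyRisk, cleanRisk, ← integral_const_mul, ← integral_const_mul,
    ← integral_add (hclean.const_mul _) (hsum.const_mul _)]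
  congr 1 with z
  rw [← Finset.add_sum_erase _ _ (Finset.mem_univ z.2)]
  ring

/-- Pointwise bounds on the sum of the losses bound its expectation. -/
theorem IsClassifier.integral_sum_loss_mem_Icc
    (hLmeas : Measurable fun pj : (Fin c → ℝ) × Fin c => L pj.1 pj.2)
    (hLbd : ∃ B : ℝ, ∀ p : Fin c → ℝ, IsPred c p → ∀ j, |L p j| ≤ B)
    {C₁ C₂ : ℝ}
    (hsum : ∀ p : Fin c → ℝ, IsPred c p → C₁ ≤ ∑ j, L p j ∧ ∑ j, L p j ≤ C₂)
    (hf : IsClassifier c f) :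
    ∫ z, ∑ j, L (f z.1) j ∂μ ∈ Set.Icc C₁ C₂ := by
  have hint : Integrable (fun z : X × Fin c => ∑ j, L (f z.1) j) μ :=
    integrable_finsetSum _ fun j _ =>
      hf.integrable_loss (y := fun _ => j) hLmeas hLbd measurable_const
  constructor
  · simpa using integral_mono (integrable_const C₁) hint fun z => (hsum _ (hf.2 z.1)).1
  · simpa using integral_mono hint (integrable_const C₂) fun z => (hsum _ (hf.2 z.1)).2

end NoisyRisk

/-- Bounded-sum losses: noisy-risk bound (Ghosh-type result). -/
theorem boundedSum_noisyRisk_bound {X : Type*} [MeasurableSpace X] {c : ℕ} (hc : 2 ≤ c)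
    (μ : Measure (X × Fin c)) [IsProbabilityMeasure μ]
    (L : (Fin c → ℝ) → Fin c → ℝ)
    (hLmeas : Measurable fun pj : (Fin c → ℝ) × Fin c => L pj.1 pj.2)
    (hLbd : ∃ B : ℝ, ∀ p : Fin c → ℝ, IsPred c p → ∀ j, |L p j| ≤ B)
    (C₁ C₂ : ℝ) (hC : C₁ ≤ C₂)
    (hsum : ∀ p : Fin c → ℝ, IsPred c p → C₁ ≤ ∑ j, L p j ∧ ∑ j, L p j ≤ C₂)
    (η : ℝ) (hη0 : 0 ≤ η) (hη1 : η ≤ 1 - 1 / (c : ℝ))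
    (fstar fhat : X → Fin c → ℝ)
    (hfstar : IsClassifier c fstar) (hfhat : IsClassifier c fhat)
    (hmin_clean : ∀ g, IsClassifier c g → cleanRisk μ L fstar ≤ cleanRisk μ L g)
    (hmin_noisy : ∀ g, IsClassifier c g → noisyRisk μ L η fhat ≤ noisyRisk μ L η g) :
    0 ≤ noisyRisk μ L η fstar - noisyRisk μ L η fhat ∧
    noisyRisk μ L η fstar - noisyRisk μ L η fhat ≤ (η / ((c : ℝ) - 1)) * (C₂ - C₁) := by
  refine ⟨sub_nonneg.2 (hmin_noisy _ hfstar), ?_⟩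
  rw [hfstar.noisyRisk_eq_s6 hLmeas hLbd, hfhat.noisyRisk_eq_s6 hLmeas hLbd]
  have hupper := (hfstar.integral_sum_loss_mem_Icc (μ := μ) hLmeas hLbd hsum).2
  have hlower := (hfhat.integral_sum_loss_mem_Icc (μ := μ) hLmeas hLbd hsum).1
  have hc' : (2 : ℝ) ≤ c := by exact_mod_cast hc
  have hc1 : 0 < (c : ℝ) - 1 := by linarith
  have hnoise : 0 ≤ η / ((c : ℝ) - 1) := div_nonneg hη0 hc1.le
  have hweight : 0 ≤ 1 - η - η / ((c : ℝ) - 1) := by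
    have hη : η * c ≤ c - 1 := by
      calc η * c ≤ (1 - 1 / (c : ℝ)) * c := by gcongr
        _ = c - 1 := by field_simp
    have hrw : 1 - η - η / ((c : ℝ) - 1) = (c - 1 - η * c) / (c - 1) := by
      field_simp
      ring
    rw [hrw]
    exact div_nonneg (by linarith) hc1.le
  have hclean := mul_le_mul_of_nonneg_left (hmin_clean _ hfhat) hweight
  have hsums := mul_le_mul_of_nonneg_left (sub_le_sub hupper hlower) hnoise
  linarith
end
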